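/- arXiv:1602.01451 — 2 statements merged into one kernel-verified Lean document; each statement's English description precedes it below -/
import Mathlib

section
/- Let k = 𝔽_q be a finite field of odd cardinality q, let a ∈ k× be a non-square, let F = k((t)), O = k[[t]], and let γ′ = [[0, a·t²],[1, 0]] ∈ M₂(F) act on F². Then an O-lattice Λ in F² with [Λ : O²] = 0 satisfies γ′Λ ⊆ Λ if and only if tO ⊕ O ⊆ Λ ⊆ O ⊕ t^{−1}O, and the set of such lattices has exactly q + 1 elements. (Equivalently, the orbital integral O_{γ′}(1_{𝔤(O)}) for SL₂ equals q + 1.) -/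
open PowerSeries LaurentSeries

/-- The `k[[t]]`-submodule `t^a · k[[t]]` of the Laurent series field `k((t))`. -/
noncomputable def tO (k : Type) [Field k] (a : ℤ) :
    Submodule (PowerSeries k) (LaurentSeries k) :=
  Submodule.span (PowerSeries k) {(HahnSeries.single a 1 : LaurentSeries k)}

/-- The lattice `t^{a 0} O ⊕ ⋯ ⊕ t^{a (n-1)} O` in `F^n`. -/
noncomputable def diagLat (k : Type) [Field k] {n : ℕ} (a : Fin n → ℤ) :
    Submodule (PowerSeries k) (Fin n → LaurentSeries k) :=
  Submodule.pi Set.univ fun i => tO k (a i)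

/-- The standard lattice `O^n`. -/
noncomputable def stdLat (k : Type) [Field k] (n : ℕ) :
    Submodule (PowerSeries k) (Fin n → LaurentSeries k) :=
  diagLat k fun _ : Fin n => 0

/-- An `O = k[[t]]`-lattice in `F^n = k((t))^n`: a finitely generated `O`-submodule
spanning `F^n` over `F`. -/
def IsLattice {k : Type} [Field k] {n : ℕ}
    (Λ : Submodule (PowerSeries k) (Fin n → LaurentSeries k)) : Prop :=
  Λ.FG ∧ Submodule.span (LaurentSeries k) (Λ : Set (Fin n → LaurentSeries k)) = ⊤

/-- The `k`-dimension of `N/(N ⊓ P)`. -/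
noncomputable def qdim {k : Type} [Field k] {V : Type} [AddCommGroup V]
    [Module (PowerSeries k) V] (N P : Submodule (PowerSeries k) V) : ℕ :=
  letI := Module.compHom (↥N ⧸ Submodule.comap N.subtype (N ⊓ P))
    (algebraMap k (PowerSeries k))
  Module.finrank k (↥N ⧸ Submodule.comap N.subtype (N ⊓ P))

/-- The relative length `[Λ₁ : Λ₂] = dim_k Λ₁/(Λ₁∩Λ₂) − dim_k Λ₂/(Λ₁∩Λ₂)`. -/
noncomputable def relIdx {k : Type} [Field k] {V : Type} [AddCommGroup V]
    [Module (PowerSeries k) V] (A B : Submodule (PowerSeries k) V) : ℤ :=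
  (qdim A B : ℤ) - (qdim B A : ℤ)

section PowerSeriesLattices

variable {k : Type} [Field k]

lemma smul_single_coeff (p : PowerSeries k) (a m : ℤ) :
    (p • (HahnSeries.single a 1 : LaurentSeries k)).coeff m =
      if m < a then 0 else PowerSeries.coeff (m - a).natAbs p := by
  obtain ⟨n, rfl⟩ : ∃ n, m = n + a := ⟨m - a, by ring⟩
  rw [Algebra.smul_def, LaurentSeries.coe_algebraMap, HahnSeries.coeff_mul_single_add, mul_one,
    PowerSeries.coeff_coe]
  simp

lemma mem_tO_iff {a : ℤ} {f : LaurentSeries k} :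
    f ∈ tO k a ↔ ∀ m < a, f.coeff m = 0 := by
  rw [tO, Submodule.mem_span_singleton]
  constructor
  · rintro ⟨p, rfl⟩ m hm
    rw [smul_single_coeff, if_pos hm]
  · intro h
    refine ⟨PowerSeries.mk fun n => f.coeff (a + n), ?_⟩
    ext m
    rw [smul_single_coeff]
    split_ifs with hm
    · exact (h m hm).symm
    · rw [PowerSeries.coeff_mk]
      congr 1
      lia

lemma mem_diagLat_iff {n : ℕ} {a : Fin n → ℤ} {v : Fin n → LaurentSeries k} :
    v ∈ diagLat k a ↔ ∀ i, ∀ m < a i, (v i).coeff m = 0 := by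
  simp [diagLat, Submodule.mem_pi, mem_tO_iff]

lemma mem_diagLat_iff_exists {n : ℕ} {a : Fin n → ℤ} {v : Fin n → LaurentSeries k} :
    v ∈ diagLat k a ↔
      ∃ p : Fin n → PowerSeries k, ∀ i, v i = p i • HahnSeries.single (a i) 1 := by
  simp only [diagLat, Submodule.mem_pi, Set.mem_univ, true_imp_iff, tO,
    Submodule.mem_span_singleton, @eq_comm _ _ (v _)]
  exact Classical.skolem

lemma diagLat_mono {n : ℕ} {a b : Fin n → ℤ} (h : b ≤ a) : diagLat k a ≤ diagLat k b :=
  fun _ hv => mem_diagLat_iff.2 fun i m hm => mem_diagLat_iff.1 hv i m (hm.trans_le (h i))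

lemma diagLat_fg {n : ℕ} (a : Fin n → ℤ) : (diagLat k a).FG :=
  Submodule.fg_pi fun _ => Submodule.fg_span_singleton _

lemma span_diagLat {n : ℕ} (a : Fin n → ℤ) :
    Submodule.span (LaurentSeries k) (diagLat k a : Set (Fin n → LaurentSeries k)) = ⊤ := by
  rw [eq_top_iff]
  intro v _
  rw [← Finset.univ_sum_single v]
  refine Submodule.sum_mem _ fun i _ => ?_
  have h : (Pi.single i (HahnSeries.single (a i) 1) : Fin n → LaurentSeries k) ∈ diagLat k a := by
    rw [mem_diagLat_iff]
    intro j m hm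
    obtain rfl | hij := eq_or_ne j i
    · rw [Pi.single_eq_same, HahnSeries.coeff_single_of_ne hm.ne]
    · simp [hij]
  have h' := Submodule.smul_mem _ (v i * HahnSeries.single (-a i) 1) (Submodule.subset_span h)
  rwa [← Pi.single_smul, smul_eq_mul, mul_assoc, HahnSeries.single_mul_single, neg_add_cancel,
    mul_one, HahnSeries.single_zero_one, mul_one] at h'

lemma isLattice_of_diagLat_le_of_le_diagLat {n : ℕ} {a b : Fin n → ℤ}
    {Λ : Submodule (PowerSeries k) (Fin n → LaurentSeries k)}
    (ha : diagLat k a ≤ Λ) (hb : Λ ≤ diagLat k b) : IsLattice Λ :=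
  ⟨(diagLat_fg b).of_le hb, top_unique <| (span_diagLat a).ge.trans (Submodule.span_mono ha)⟩

lemma exists_le_diagLat {n : ℕ} {Λ : Submodule (PowerSeries k) (Fin n → LaurentSeries k)}
    (hΛ : Λ.FG) : ∃ N : ℤ, ∀ a : Fin n → ℤ, (∀ i, a i ≤ N) → Λ ≤ diagLat k a := by
  induction Λ, hΛ using Submodule.fg_induction with
  | singleton v =>
    have h : ∀ i, ∃ N : ℤ, ∀ m < N, (v i).coeff m = 0 := fun i =>
      ⟨(v i).order, fun m hm => HahnSeries.coeff_eq_zero_of_lt_order hm⟩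
    choose N hN using h
    obtain ⟨M, hM⟩ := (Set.finite_range N).bddBelow
    refine ⟨M, fun a ha => ?_⟩
    rw [Submodule.span_singleton_le_iff_mem, mem_diagLat_iff]
    exact fun i m hm => hN i m (hm.trans_le ((ha i).trans (hM ⟨i, rfl⟩)))
  | sup Λ₁ Λ₂ h₁ h₂ ih₁ ih₂ =>
    obtain ⟨N₁, hN₁⟩ := ih₁
    obtain ⟨N₂, hN₂⟩ := ih₂
    exact ⟨min N₁ N₂, fun a ha => sup_le (hN₁ a fun i => (ha i).trans (min_le_left _ _))
      (hN₂ a fun i => (ha i).trans (min_le_right _ _))⟩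

/-- The lowest coefficients of a vector of `t^{a 0} O ⊕ ⋯ ⊕ t^{a (n-1)} O`. -/
noncomputable def lowestCoeffs {n : ℕ} (a : Fin n → ℤ) :
    diagLat k a →ₛₗ[(PowerSeries.constantCoeff : PowerSeries k →+* k)] (Fin n → k) where
  toFun v i := (v.1 i).coeff (a i)
  map_add' v w := by
    ext i
    simp
  map_smul' p v := by
    ext i
    obtain ⟨q, hq⟩ := mem_diagLat_iff_exists.1 v.2
    simp [hq, smul_smul, smul_single_coeff]

@[simp] lemma lowestCoeffs_apply {n : ℕ} (a : Fin n → ℤ) (v : diagLat k a) (i : Fin n) :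
    lowestCoeffs a v i = (v.1 i).coeff (a i) := rfl

lemma lowestCoeffs_surjective {n : ℕ} (a : Fin n → ℤ) :
    Function.Surjective (lowestCoeffs (k := k) a) := by
  intro w
  refine ⟨⟨fun i => HahnSeries.single (a i) (w i), mem_diagLat_iff.2 fun i m hm =>
    HahnSeries.coeff_single_of_ne hm.ne⟩, ?_⟩
  ext i
  simp

lemma map_ker_lowestCoeffs {n : ℕ} (a : Fin n → ℤ) :
    (lowestCoeffs (k := k) a).ker.map (diagLat k a).subtype = diagLat k (a + 1) := by
  ext v
  simp only [mem_diagLat_iff, Pi.add_apply, Pi.one_apply, Int.lt_add_one_iff]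
  constructor
  · rintro ⟨v, hv, rfl⟩ i m hm
    obtain hm | rfl := hm.lt_or_eq
    exacts [mem_diagLat_iff.1 v.2 i m hm, congrFun (LinearMap.mem_ker.1 hv) i]
  · exact fun h => ⟨⟨v, mem_diagLat_iff.2 fun i m hm => h i m hm.le⟩,
      LinearMap.mem_ker.2 (funext fun i => h i _ le_rfl), rfl⟩

instance : RingHomSurjective (PowerSeries.constantCoeff : PowerSeries k →+* k) :=
  ⟨PowerSeries.constantCoeff_surj⟩

/-- The lattice between `t^{a + 1} O` and `t^a O` whose lowest coefficients form the subspace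
`W` of `k^n`. -/
noncomputable def latticeOfSubspace {n : ℕ} (a : Fin n → ℤ) (W : Submodule k (Fin n → k)) :
    Submodule (PowerSeries k) (Fin n → LaurentSeries k) :=
  (W.comap (lowestCoeffs a)).map (diagLat k a).subtype

lemma latticeOfSubspace_le {n : ℕ} (a : Fin n → ℤ) (W : Submodule k (Fin n → k)) :
    latticeOfSubspace a W ≤ diagLat k a :=
  Submodule.map_subtype_le _ _

lemma le_latticeOfSubspace {n : ℕ} (a : Fin n → ℤ) (W : Submodule k (Fin n → k)) :
    diagLat k (a + 1) ≤ latticeOfSubspace a W := by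
  rw [← map_ker_lowestCoeffs]
  exact Submodule.map_mono fun v hv => by simp [LinearMap.mem_ker.1 hv]

lemma mem_latticeOfSubspace {n : ℕ} {a : Fin n → ℤ} {W : Submodule k (Fin n → k)}
    {v : Fin n → LaurentSeries k} :
    v ∈ latticeOfSubspace a W ↔ ∃ h : v ∈ diagLat k a, lowestCoeffs a ⟨v, h⟩ ∈ W := by
  simp [latticeOfSubspace]

lemma latticeOfSubspace_injective {n : ℕ} (a : Fin n → ℤ) :
    Function.Injective (latticeOfSubspace (k := k) a) :=
  (Submodule.map_injective_of_injective (diagLat k a).subtype_injective).comp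
    (Submodule.comap_injective_of_surjective (lowestCoeffs_surjective a))

lemma exists_latticeOfSubspace_eq {n : ℕ} {a : Fin n → ℤ}
    {Λ : Submodule (PowerSeries k) (Fin n → LaurentSeries k)}
    (h₁ : diagLat k (a + 1) ≤ Λ) (h₂ : Λ ≤ diagLat k a) :
    ∃ W, latticeOfSubspace a W = Λ := by
  refine ⟨(Λ.comap (diagLat k a).subtype).map (lowestCoeffs a), ?_⟩
  rw [latticeOfSubspace, Submodule.comap_map_eq, Submodule.map_sup, map_ker_lowestCoeffs,
    Submodule.map_comap_subtype, inf_eq_right.2 h₂, sup_eq_left.2 h₁]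

lemma qdim_eq_finrank {V U : Type} [AddCommGroup V] [Module (PowerSeries k) V] [AddCommGroup U]
    [Module k U] {N P : Submodule (PowerSeries k) V}
    (f : N →ₛₗ[(PowerSeries.constantCoeff : PowerSeries k →+* k)] U)
    (hf : Function.Surjective f) (hker : ∀ v : N, f v = 0 ↔ v.1 ∈ P) :
    qdim N P = Module.finrank k U := by
  have hker' : f.ker = Submodule.comap N.subtype (N ⊓ P) := by
    ext v
    simp [hker]
  let g := (Submodule.comap N.subtype (N ⊓ P)).liftQ f hker'.ge
  let := Module.compHom (↥N ⧸ Submodule.comap N.subtype (N ⊓ P))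
    (algebraMap k (PowerSeries k))
  let g' : (↥N ⧸ Submodule.comap N.subtype (N ⊓ P)) →ₗ[k] U :=
    { toFun := g
      map_add' := map_add g
      map_smul' := fun c x => by
        change g (algebraMap k (PowerSeries k) c • x) = _
        rw [map_smulₛₗ]
        simp }
  have hinj : Function.Injective g :=
    LinearMap.ker_eq_bot.1 (Submodule.ker_liftQ_eq_bot _ _ _ hker'.le)
  have hsurj : Function.Surjective g := fun u =>
    let ⟨v, hv⟩ := hf u
    ⟨Submodule.Quotient.mk v, hv⟩
  exact (LinearEquiv.ofBijective g' ⟨hinj, hsurj⟩).finrank_eq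

lemma qdim_latticeOfSubspace {n : ℕ} (a : Fin n → ℤ) (W W' : Submodule k (Fin n → k)) :
    qdim (latticeOfSubspace a W) (latticeOfSubspace a W') + Module.finrank k ↥(W ⊓ W') =
      Module.finrank k W := by
  let f₀ : latticeOfSubspace a W →ₛₗ[(PowerSeries.constantCoeff : PowerSeries k →+* k)] W :=
    ((lowestCoeffs a).comp (Submodule.inclusion (latticeOfSubspace_le a W))).codRestrict W
      fun v => (mem_latticeOfSubspace.1 v.2).2
  have hf₀ : Function.Surjective f₀ := by
    rintro ⟨w, hw⟩
    obtain ⟨v, rfl⟩ := lowestCoeffs_surjective a w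
    exact ⟨⟨v, mem_latticeOfSubspace.2 ⟨v.2, hw⟩⟩, rfl⟩
  have h := qdim_eq_finrank (P := latticeOfSubspace a W')
    ((W'.comap W.subtype).mkQ.comp f₀) ((Submodule.mkQ_surjective _).comp hf₀) (fun v => by
      have hv := latticeOfSubspace_le a W v.2
      simp only [LinearMap.comp_apply, Submodule.mkQ_apply, Submodule.Quotient.mk_eq_zero,
        Submodule.mem_comap, Submodule.subtype_apply, mem_latticeOfSubspace, hv, exists_true_left]
      rfl)
  rw [h, ← Submodule.map_comap_subtype, Submodule.finrank_map_subtype_eq,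
    Submodule.finrank_quotient_add_finrank]

lemma relIdx_latticeOfSubspace {n : ℕ} (a : Fin n → ℤ) (W W' : Submodule k (Fin n → k)) :
    relIdx (latticeOfSubspace a W) (latticeOfSubspace a W') =
      (Module.finrank k W : ℤ) - Module.finrank k W' := by
  have h₁ := qdim_latticeOfSubspace a W W'
  have h₂ := qdim_latticeOfSubspace a W' W
  rw [inf_comm] at h₂
  rw [relIdx]
  lia

lemma qdim_eq_zero_of_le {V : Type} [AddCommGroup V] [Module (PowerSeries k) V]
    {N P : Submodule (PowerSeries k) V} (h : N ≤ P) : qdim N P = 0 := by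
  rw [qdim_eq_finrank (U := PUnit.{1}) (k := k) 0 (fun _ => ⟨0, rfl⟩)
    (fun v => by simp [h v.2])]
  exact Module.finrank_zero_of_subsingleton

lemma finite_of_X_pow_smul_eq_zero [Finite k] {Q : Type*} [AddCommGroup Q]
    [Module (PowerSeries k) Q] [Module.Finite (PowerSeries k) Q] (m : ℕ)
    (h : ∀ x : Q, (PowerSeries.X : PowerSeries k) ^ m • x = 0) : Finite Q := by
  obtain ⟨n, g, hg⟩ := Module.Finite.exists_fin' (PowerSeries k) Q
  let trunc (c : Fin m → k) : PowerSeries k :=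
    PowerSeries.mk fun i => if hi : i < m then c ⟨i, hi⟩ else 0
  refine Finite.of_surjective (fun c : Fin n → Fin m → k => g fun j => trunc (c j)) fun x => ?_
  obtain ⟨p, rfl⟩ := hg x
  refine ⟨fun j i => PowerSeries.coeff i (p j), ?_⟩
  have hdvd : ∀ j, (PowerSeries.X : PowerSeries k) ^ m ∣
      p j - trunc fun i => PowerSeries.coeff i (p j) := fun j =>
    PowerSeries.X_pow_dvd_iff.2 fun i hi => by simp [trunc, hi]
  choose r hr using hdvd
  rw [eq_comm, ← sub_eq_zero, ← map_sub, ← h (g r), ← map_smul]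
  congr 1
  ext1 j
  exact hr j

lemma qdim_pos [Finite k] {V : Type} [AddCommGroup V] [Module (PowerSeries k) V]
    {N P : Submodule (PowerSeries k) V} (hN : N.FG) (hNP : ¬ N ≤ P) (m : ℕ)
    (h : ∀ x ∈ N, (PowerSeries.X : PowerSeries k) ^ m • x ∈ P) : 0 < qdim N P := by
  have : Module.Finite (PowerSeries k) N := Module.Finite.iff_fg.2 hN
  have : Finite (↥N ⧸ Submodule.comap N.subtype (N ⊓ P)) := by
    refine finite_of_X_pow_smul_eq_zero (k := k) m fun x => ?_
    obtain ⟨x, rfl⟩ := Submodule.Quotient.mk_surjective _ x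
    rw [← Submodule.Quotient.mk_smul, Submodule.Quotient.mk_eq_zero]
    exact ⟨N.smul_mem _ x.2, h x x.2⟩
  have : Nontrivial (↥N ⧸ Submodule.comap N.subtype (N ⊓ P)) := by
    rw [Submodule.Quotient.nontrivial_iff]
    refine fun htop => hNP fun x hx => ?_
    exact (htop.ge (Submodule.mem_top (x := ⟨x, hx⟩))).2
  let := Module.compHom (↥N ⧸ Submodule.comap N.subtype (N ⊓ P))
    (algebraMap k (PowerSeries k))
  exact Module.finrank_pos (R := k) (M := ↥N ⧸ Submodule.comap N.subtype (N ⊓ P))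

lemma X_pow_smul_mem_diagLat {n : ℕ} {a b : Fin n → ℤ} {m : ℕ} (h : ∀ i, b i ≤ a i + m)
    {v : Fin n → LaurentSeries k} (hv : v ∈ diagLat k a) :
    (PowerSeries.X : PowerSeries k) ^ m • v ∈ diagLat k b := by
  obtain ⟨p, hp⟩ := mem_diagLat_iff_exists.1 hv
  refine mem_diagLat_iff.2 fun i j hj => ?_
  rw [Pi.smul_apply, hp, smul_smul, smul_single_coeff, PowerSeries.coeff_X_pow_mul']
  specialize h i
  split_ifs with h₁ h₂
  · rfl
  · lia
  · rfl

end PowerSeriesLattices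

section AntiDiagonal

variable {k : Type} [Field k]

lemma antidiagonal_mulVec (a : k) (v : Fin 2 → LaurentSeries k) :
    (Matrix.of ![![0, HahnSeries.single 2 a], ![1, 0]]).mulVec v =
      ![HahnSeries.single 2 a * v 1, v 0] := by
  ext1 i
  fin_cases i <;> simp [Matrix.mulVec, dotProduct, Fin.sum_univ_two]

lemma smul_single_eq (p : PowerSeries k) (m n : ℤ) (h : n = m + 1) :
    p • (HahnSeries.single n 1 : LaurentSeries k) =
      (p * PowerSeries.X) • HahnSeries.single m 1 := by
  rw [mul_smul]
  congr 1
  rw [Algebra.smul_def, LaurentSeries.coe_algebraMap, HahnSeries.ofPowerSeries_X,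
    HahnSeries.single_mul_single, h, mul_one, add_comm]

lemma single_mul_smul_single (a : k) (p : PowerSeries k) (l m n : ℤ) (h : n = l + m) :
    HahnSeries.single l a * (p • (HahnSeries.single m 1 : LaurentSeries k)) =
      (PowerSeries.C a * p) • HahnSeries.single n 1 := by
  simp only [Algebra.smul_def, LaurentSeries.coe_algebraMap, map_mul, HahnSeries.ofPowerSeries_C]
  rw [mul_left_comm, mul_assoc, mul_left_comm (HahnSeries.C a), HahnSeries.C_apply,
    HahnSeries.single_mul_single, HahnSeries.single_mul_single, mul_one, zero_add, h]

lemma isUnit_sq_sub_mul_sq {a : k} (hsq : ¬ IsSquare a) {p r : PowerSeries k}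
    (h : ¬ (PowerSeries.X ∣ p ∧ PowerSeries.X ∣ r)) :
    IsUnit (p * p - PowerSeries.C a * (r * r)) := by
  rw [PowerSeries.X_dvd_iff, PowerSeries.X_dvd_iff] at h
  rw [PowerSeries.isUnit_iff_constantCoeff, isUnit_iff_ne_zero]
  simp only [map_sub, map_mul, PowerSeries.constantCoeff_C]
  intro h0
  rw [sub_eq_zero] at h0
  by_cases hr : PowerSeries.constantCoeff r = 0
  · rw [hr, mul_zero, mul_zero, mul_self_eq_zero] at h0
    exact h ⟨h0, hr⟩
  · refine hsq ⟨PowerSeries.constantCoeff p / PowerSeries.constantCoeff r, ?_⟩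
    field_simp
    linear_combination -h0

lemma diagLat_le_of_mem {a : k} (hsq : ¬ IsSquare a) {n : ℤ}
    {Λ : Submodule (PowerSeries k) (Fin 2 → LaurentSeries k)} {v : Fin 2 → LaurentSeries k}
    (hv : v ∈ Λ) (hγv : ![HahnSeries.single 2 a * v 1, v 0] ∈ Λ)
    (hvn : v ∈ diagLat k ![n, n - 1]) (hvn' : v ∉ diagLat k ![n + 1, n]) :
    diagLat k ![n + 1, n] ≤ Λ := by
  obtain ⟨p, hp⟩ := mem_diagLat_iff_exists.1 hvn
  simp only [Fin.forall_fin_two, Matrix.cons_val_zero, Matrix.cons_val_one] at hp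
  obtain ⟨hp0, hp1⟩ := hp
  have hX : ¬ (PowerSeries.X ∣ p 0 ∧ PowerSeries.X ∣ p 1) := by
    rintro ⟨⟨r, hr⟩, ⟨s, hs⟩⟩
    refine hvn' (mem_diagLat_iff_exists.2 ⟨![r, s], Fin.forall_fin_two.2 ⟨?_, ?_⟩⟩)
    · simp only [Matrix.cons_val_zero]
      rw [hp0, smul_single_eq _ n _ rfl, hr, mul_comm]
    · simp only [Matrix.cons_val_one, Matrix.cons_val_zero]
      rw [hp1, smul_single_eq _ (n - 1) n (by ring), hs, mul_comm]
  obtain ⟨u, hu⟩ := (isUnit_sq_sub_mul_sq hsq hX).exists_left_inv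
  intro w hw
  obtain ⟨q, hq⟩ := mem_diagLat_iff_exists.1 hw
  simp only [Fin.forall_fin_two, Matrix.cons_val_zero, Matrix.cons_val_one] at hq
  obtain ⟨hq0, hq1⟩ := hq
  have hw' : w = (u * (p 0 * q 0 - PowerSeries.C a * (p 1 * q 1)) * PowerSeries.X) • v +
      (u * (p 0 * q 1 - p 1 * q 0)) • ![HahnSeries.single 2 a * v 1, v 0] := by
    ext1 i
    fin_cases i
    · simp only [Fin.zero_eta, Pi.add_apply, Pi.smul_apply, Matrix.cons_val_zero]
      rw [hq0, hp0, hp1, single_mul_smul_single a _ 2 (n - 1) (n + 1) (by ring),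
        smul_single_eq _ n (n + 1) rfl, smul_single_eq _ n (n + 1) rfl, smul_smul, smul_smul,
        ← add_smul]
      congr 1
      linear_combination (-(q 0 * PowerSeries.X)) * hu
    · simp only [Fin.mk_one, Pi.add_apply, Pi.smul_apply, Matrix.cons_val_one,
        Matrix.cons_val_zero]
      rw [hq1, hp0, hp1, smul_single_eq _ (n - 1) n (by ring),
        smul_single_eq _ (n - 1) n (by ring), smul_smul, smul_smul, ← add_smul]
      congr 1
      linear_combination (-(q 1 * PowerSeries.X)) * hu
  rw [hw']
  exact Λ.add_mem (Λ.smul_mem _ hv) (Λ.smul_mem _ hγv)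

lemma exists_diagLat_le_le {a : k} (hsq : ¬ IsSquare a)
    {Λ : Submodule (PowerSeries k) (Fin 2 → LaurentSeries k)} (hΛ : IsLattice Λ)
    (hγ : ∀ v ∈ Λ, ![HahnSeries.single 2 a * v 1, v 0] ∈ Λ) :
    ∃ n : ℤ, diagLat k ![n + 1, n] ≤ Λ ∧ Λ ≤ diagLat k ![n, n - 1] := by
  have hne : Λ ≠ ⊥ := by
    rintro rfl
    have h := hΛ.2
    rw [Submodule.bot_coe, Submodule.span_zero_singleton] at h
    exact bot_ne_top h
  obtain ⟨v, hv, hv0⟩ := Submodule.exists_mem_ne_zero_of_ne_bot hne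
  obtain ⟨i, hi⟩ := Function.ne_iff.1 hv0
  obtain ⟨n, hn, hmax⟩ := Int.exists_greatest_of_bdd
    (P := fun n => Λ ≤ diagLat k ![n, n - 1])
    ⟨(v i).order + 1, fun n hn => by
      by_contra! hlt
      refine hi (HahnSeries.coeff_order_eq_zero.1 <| mem_diagLat_iff.1 (hn hv) i _ ?_)
      fin_cases i <;> simp at hlt ⊢ <;> lia⟩
    (by
      obtain ⟨N, hN⟩ := exists_le_diagLat hΛ.1
      exact ⟨N, hN _ (by simp [Fin.forall_fin_two])⟩)
  have hn' : ¬ Λ ≤ diagLat k ![n + 1, n] := fun h => by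
    have := hmax (n + 1) (by simpa using h)
    lia
  obtain ⟨w, hw, hwn⟩ := SetLike.not_le_iff_exists.1 hn'
  exact ⟨n, diagLat_le_of_mem hsq hw (hγ w hw) (hn hw) hwn, hn⟩

lemma relIdx_stdLat_pos [Finite k] {n : ℤ} (hn : n < 0)
    {Λ : Submodule (PowerSeries k) (Fin 2 → LaurentSeries k)}
    (h₁ : diagLat k ![n + 1, n] ≤ Λ) (h₂ : Λ ≤ diagLat k ![n, n - 1]) :
    0 < relIdx Λ (stdLat k 2) := by
  have hle : diagLat k ![0, -1] ≤ Λ :=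
    (diagLat_mono (by simp [Pi.le_def, Fin.forall_fin_two]; lia)).trans h₁
  have hstd : stdLat k 2 ≤ Λ :=
    (diagLat_mono (by simp [Pi.le_def, Fin.forall_fin_two])).trans hle
  have hΛ : ¬ Λ ≤ stdLat k 2 := fun h => by
    have hmem : ![0, HahnSeries.single (-1) 1] ∈ diagLat k ![0, -1] := by
      rw [mem_diagLat_iff, Fin.forall_fin_two]
      exact ⟨by simp, fun m hm => HahnSeries.coeff_single_of_ne hm.ne⟩
    simpa using mem_diagLat_iff.1 (h (hle hmem)) 1 (-1) (by simp)
  rw [relIdx, qdim_eq_zero_of_le hstd]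
  have := qdim_pos ((diagLat_fg _).of_le h₂) hΛ (1 - n).toNat fun v hv =>
    X_pow_smul_mem_diagLat (by simp [Fin.forall_fin_two]; lia) (h₂ hv)
  lia

lemma relIdx_stdLat_neg [Finite k] {n : ℤ} (hn : 0 < n)
    {Λ : Submodule (PowerSeries k) (Fin 2 → LaurentSeries k)}
    (h₁ : diagLat k ![n + 1, n] ≤ Λ) (h₂ : Λ ≤ diagLat k ![n, n - 1]) :
    relIdx Λ (stdLat k 2) < 0 := by
  have hle : Λ ≤ diagLat k ![1, 0] :=
    h₂.trans (diagLat_mono (by simp [Pi.le_def, Fin.forall_fin_two]; lia))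
  have hstd : Λ ≤ stdLat k 2 :=
    hle.trans (diagLat_mono (by simp [Pi.le_def, Fin.forall_fin_two]))
  have hΛ : ¬ stdLat k 2 ≤ Λ := fun h => by
    have hmem : ![HahnSeries.single 0 1, 0] ∈ stdLat k 2 := by
      rw [stdLat, mem_diagLat_iff, Fin.forall_fin_two]
      exact ⟨fun m hm => HahnSeries.coeff_single_of_ne hm.ne, by simp⟩
    simpa using mem_diagLat_iff.1 (hle (h hmem)) 0 0 (by simp)
  rw [relIdx, qdim_eq_zero_of_le hstd]
  have := qdim_pos (diagLat_fg _) hΛ (n + 1).toNat fun v hv =>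
    h₁ (X_pow_smul_mem_diagLat (by simp [Fin.forall_fin_two]) hv)
  lia

lemma stable_of_between (a : k) {Λ : Submodule (PowerSeries k) (Fin 2 → LaurentSeries k)}
    (h₁ : diagLat k ![1, 0] ≤ Λ) (h₂ : Λ ≤ diagLat k ![0, -1]) {v : Fin 2 → LaurentSeries k}
    (hv : v ∈ Λ) : ![HahnSeries.single 2 a * v 1, v 0] ∈ Λ := by
  obtain ⟨p, hp⟩ := mem_diagLat_iff_exists.1 (h₂ hv)
  refine h₁ (mem_diagLat_iff_exists.2 ⟨![PowerSeries.C a * p 1, p 0], ?_⟩)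
  rw [Fin.forall_fin_two] at hp ⊢
  refine ⟨?_, by simpa using hp.1⟩
  simp only [Matrix.cons_val_zero, hp.2, Matrix.cons_val_one]
  exact single_mul_smul_single a _ 2 (-1) 1 (by ring)

lemma stable_iff_between [Finite k] {a : k} (hsq : ¬ IsSquare a)
    {Λ : Submodule (PowerSeries k) (Fin 2 → LaurentSeries k)} (hΛ : IsLattice Λ)
    (h0 : relIdx Λ (stdLat k 2) = 0) :
    (∀ v ∈ Λ, ![HahnSeries.single 2 a * v 1, v 0] ∈ Λ) ↔
      diagLat k ![1, 0] ≤ Λ ∧ Λ ≤ diagLat k ![0, -1] := by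
  refine ⟨fun h => ?_, fun h v hv => stable_of_between a h.1 h.2 hv⟩
  obtain ⟨n, h₁, h₂⟩ := exists_diagLat_le_le hsq hΛ h
  obtain hn | rfl | hn := lt_trichotomy n 0
  · exact absurd h0 (relIdx_stdLat_pos hn h₁ h₂).ne'
  · simpa using ⟨h₁, h₂⟩
  · exact absurd h0 (relIdx_stdLat_neg hn h₁ h₂).ne

lemma stdLat_eq_latticeOfSubspace :
    stdLat k 2 = latticeOfSubspace ![0, -1] (k ∙ (Pi.single 0 1 : Fin 2 → k)) := by
  ext v
  simp only [stdLat, mem_latticeOfSubspace, mem_diagLat_iff, Submodule.mem_span_singleton,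
    Fin.forall_fin_two, funext_iff, lowestCoeffs_apply]
  constructor
  · rintro ⟨h0, h1⟩
    refine ⟨⟨by simpa using h0, fun m hm => h1 m (hm.trans (by simp))⟩, (v 0).coeff 0, ?_⟩
    simpa using (h1 (-1) (by simp)).symm
  · rintro ⟨⟨h0, h1⟩, c, -, hc⟩
    refine ⟨by simpa using h0, fun m hm => ?_⟩
    obtain hm | rfl : m < -1 ∨ m = -1 := by lia
    · exact h1 m (by simpa using hm)
    · simpa using hc.symm

lemma setOf_between_eq_image :
    {Λ : Submodule (PowerSeries k) (Fin 2 → LaurentSeries k) |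
      relIdx Λ (stdLat k 2) = 0 ∧ diagLat k ![1, 0] ≤ Λ ∧ Λ ≤ diagLat k ![0, -1]} =
      latticeOfSubspace ![0, -1] '' {W | Module.finrank k W = 1} := by
  have hadd : (![0, -1] + 1 : Fin 2 → ℤ) = ![1, 0] := by
    ext i
    fin_cases i <;> simp
  have hidx (W : Submodule k (Fin 2 → k)) :
      relIdx (latticeOfSubspace ![0, -1] W) (stdLat k 2) = 0 ↔ Module.finrank k W = 1 := by
    rw [stdLat_eq_latticeOfSubspace, relIdx_latticeOfSubspace, finrank_span_singleton (by simp)]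
    lia
  ext Λ
  constructor
  · rintro ⟨h0, h₁, h₂⟩
    obtain ⟨W, rfl⟩ := exists_latticeOfSubspace_eq (hadd ▸ h₁) h₂
    exact ⟨W, (hidx W).1 h0, rfl⟩
  · rintro ⟨W, hW, rfl⟩
    exact ⟨(hidx W).2 hW, hadd ▸ le_latticeOfSubspace _ W, latticeOfSubspace_le _ W⟩

lemma ncard_finrank_eq_one [Finite k] {V : Type*} [AddCommGroup V] [Module k V]
    (h : Module.finrank k V = 2) :
    {W : Submodule k V | Module.finrank k W = 1}.ncard = Nat.card k + 1 := by
  rw [← Projectivization.card_of_finrank_two k V h,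
    Nat.card_congr (Projectivization.equivSubmodule k V)]
  rfl

end AntiDiagonal

theorem stmt14 (k : Type) [Field k] [Fintype k] (hodd : Odd (Fintype.card k))
    (a : k) (ha : a ≠ 0) (hsq : ¬ IsSquare a)
    (γ' : Matrix (Fin 2) (Fin 2) (LaurentSeries k))
    (hγ' : γ' = Matrix.of ![![0, HahnSeries.single 2 a], ![1, 0]]) :
    (∀ Λ : Submodule (PowerSeries k) (Fin 2 → LaurentSeries k),
      IsLattice Λ → relIdx Λ (stdLat k 2) = 0 →
        ((∀ v ∈ Λ, γ'.mulVec v ∈ Λ) ↔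
          diagLat k ![1, 0] ≤ Λ ∧ Λ ≤ diagLat k ![0, -1])) ∧
    {Λ : Submodule (PowerSeries k) (Fin 2 → LaurentSeries k) |
        IsLattice Λ ∧ relIdx Λ (stdLat k 2) = 0 ∧
          ∀ v ∈ Λ, γ'.mulVec v ∈ Λ}.Finite ∧
    {Λ : Submodule (PowerSeries k) (Fin 2 → LaurentSeries k) |
        IsLattice Λ ∧ relIdx Λ (stdLat k 2) = 0 ∧
          ∀ v ∈ Λ, γ'.mulVec v ∈ Λ}.ncard = Fintype.card k + 1 := by
  subst hγ'
  simp only [antidiagonal_mulVec]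
  have hset : {Λ : Submodule (PowerSeries k) (Fin 2 → LaurentSeries k) |
      IsLattice Λ ∧ relIdx Λ (stdLat k 2) = 0 ∧
        ∀ v ∈ Λ, ![HahnSeries.single 2 a * v 1, v 0] ∈ Λ} =
      latticeOfSubspace ![0, -1] '' {W | Module.finrank k W = 1} := by
    rw [← setOf_between_eq_image]
    ext Λ
    constructor
    · exact fun ⟨hΛ, h0, h⟩ => ⟨h0, (stable_iff_between hsq hΛ h0).1 h⟩
    · exact fun ⟨h0, h₁, h₂⟩ => ⟨isLattice_of_diagLat_le_of_le_diagLat h₁ h₂, h0,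
        fun v hv => stable_of_between a h₁ h₂ hv⟩
  rw [hset]
  refine ⟨fun Λ hΛ h0 => stable_iff_between hsq hΛ h0, (Set.toFinite _).image _, ?_⟩
  rw [Set.ncard_image_of_injective _ (latticeOfSubspace_injective _),
    ncard_finrank_eq_one (by simp), Nat.card_eq_fintype_card]
end

section
/- Let k = 𝔽_q be a finite field of odd cardinality q, let F = k((t)), O = k[[t]], and let γ = [[0, t²],[t, 0]] ∈ M₂(F) act on F². Then the set of O-lattices Λ in F² with [Λ : O²] = 0 and γΛ ⊆ Λ is finite with exactly q + 1 elements. (Equivalently, the orbital integral O_γ(1_{𝔤(O)}) for SL₂ equals q + 1 in this ramified case.) -/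
open PowerSeries LaurentSeries

section OneDimensional

variable {k : Type} [Field k]

theorem mem_tO_iff_exists {a : ℤ} {x : LaurentSeries k} :
    x ∈ tO k a ↔ ∃ o : PowerSeries k, o • (HahnSeries.single a 1 : LaurentSeries k) = x :=
  Submodule.mem_span_singleton

theorem powerSeries_smul_eq (o : PowerSeries k) (x : LaurentSeries k) :
    o • x = (o : LaurentSeries k) * x :=
  rfl

theorem mem_tO {a : ℤ} {x : LaurentSeries k} :
    x ∈ tO k a ↔ ∀ n < a, x.coeff n = 0 := by
  rw [mem_tO_iff_exists]
  constructor
  · rintro ⟨o, rfl⟩ n hn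
    rw [powerSeries_smul_eq, HahnSeries.coeff_mul_single, PowerSeries.coeff_coe,
      if_pos (by omega), zero_mul]
  · intro h
    refine ⟨PowerSeries.mk fun n => x.coeff (n + a), ?_⟩
    ext n
    rw [powerSeries_smul_eq, HahnSeries.coeff_mul_single, PowerSeries.coeff_coe, mul_one]
    split_ifs with hn
    · exact (h n (by omega)).symm
    · rw [PowerSeries.coeff_mk]
      congr 1
      omega

theorem tO_mono {a b : ℤ} (h : b ≤ a) : tO k a ≤ tO k b := fun _ hx =>
  mem_tO.2 fun n hn => mem_tO.1 hx n (by omega)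

theorem single_mem_tO {a n : ℤ} (h : a ≤ n) (c : k) :
    (HahnSeries.single n c : LaurentSeries k) ∈ tO k a :=
  mem_tO.2 fun m hm => HahnSeries.coeff_single_of_ne (by omega)

theorem mul_mem_tO {a b c : ℤ} {x y : LaurentSeries k} (hx : x ∈ tO k a) (hy : y ∈ tO k b)
    (h : c ≤ a + b) : x * y ∈ tO k c := by
  obtain ⟨o, rfl⟩ := mem_tO_iff_exists.1 hx
  obtain ⟨p, rfl⟩ := mem_tO_iff_exists.1 hy
  rw [smul_mul_smul_comm, HahnSeries.single_mul_single, mul_one]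
  exact Submodule.smul_mem _ _ (single_mem_tO h 1)

theorem single_mul_mem_tO {a b : ℤ} {y : LaurentSeries k} (n : ℤ) (c : k) (hy : y ∈ tO k b)
    (h : a ≤ n + b) : HahnSeries.single n c * y ∈ tO k a :=
  mul_mem_tO (single_mem_tO le_rfl c) hy h

theorem single_mul_single_neg (a : ℤ) :
    (HahnSeries.single a 1 * HahnSeries.single (-a) 1 : LaurentSeries k) = 1 := by
  rw [HahnSeries.single_mul_single, add_neg_cancel, mul_one]
  rfl

theorem mem_tO_order (x : LaurentSeries k) : x ∈ tO k x.order :=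
  mem_tO.2 fun _ hn => HahnSeries.coeff_eq_zero_of_lt_order hn

theorem le_order_of_mem_tO {a : ℤ} {x : LaurentSeries k} (hx : x ∈ tO k a) (h0 : x ≠ 0) :
    a ≤ x.order := by
  by_contra! h
  exact h0 (HahnSeries.leadingCoeff_eq_zero.1 (by
    rw [HahnSeries.leadingCoeff_eq]; exact mem_tO.1 hx _ h))

theorem exists_coe_eq_of_mem_tO_zero {x : LaurentSeries k} (hx : x ∈ tO k 0) :
    ∃ o : PowerSeries k, (o : LaurentSeries k) = x := by
  obtain ⟨o, rfl⟩ := mem_tO_iff_exists.1 hx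
  exact ⟨o, (mul_one (o : LaurentSeries k)).symm⟩

/-- A bounded nonzero `k[[t]]`-submodule of `k((t))` is generated by a power of `t`. -/
theorem exists_eq_tO {S : Submodule (PowerSeries k) (LaurentSeries k)} (hS : S ≠ ⊥) {M : ℤ}
    (hM : S ≤ tO k M) : ∃ a, S = tO k a := by
  obtain ⟨x₀, hx₀, hne⟩ := S.exists_mem_ne_zero_of_ne_bot hS
  obtain ⟨a, ⟨x, hx, hx0, rfl⟩, hmin⟩ :=
    Int.exists_least_of_bdd (P := fun n => ∃ x ∈ S, x ≠ 0 ∧ x.order = n)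
      ⟨M, by rintro _ ⟨x, hx, h0, rfl⟩; exact le_order_of_mem_tO (hM hx) h0⟩
      ⟨_, x₀, hx₀, hne, rfl⟩
  refine ⟨x.order, le_antisymm (fun y hy => ?_) ?_⟩
  · by_cases h0 : y = 0
    · rw [h0]; exact zero_mem _
    · exact tO_mono (hmin _ ⟨y, hy, h0, rfl⟩) (mem_tO_order y)
  · rw [tO, Submodule.span_singleton_le_iff_mem]
    set s : LaurentSeries k := HahnSeries.single x.order 1 with hs
    have hs0 : s ≠ 0 := HahnSeries.single_ne_zero one_ne_zero
    have hmul : x * (x⁻¹ * s) = s := mul_inv_cancel_left₀ hx0 s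
    have hy0 : x⁻¹ * s ≠ 0 := mul_ne_zero (inv_ne_zero hx0) hs0
    have hord : x.order + (x⁻¹ * s).order = x.order := by
      rw [← HahnSeries.order_mul hx0 hy0, hmul, hs, HahnSeries.order_single one_ne_zero]
    obtain ⟨o, ho⟩ := exists_coe_eq_of_mem_tO_zero
      (tO_mono (k := k) (by omega) (mem_tO_order (x⁻¹ * s)))
    rw [← hmul, ← ho, mul_comm]
    exact S.smul_mem o hx

/-- An odd power of `t` cannot cancel the polar part of a square. -/
theorem integral_of_single_sub_sq {n : ℤ} (hn : Odd n) {h : LaurentSeries k}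
    (H : HahnSeries.single n 1 - h * h ∈ tO k 0) : 0 ≤ n ∧ h ∈ tO k 0 := by
  have hh : h ∈ tO k 0 := by
    by_contra hc
    have h0 : h ≠ 0 := by rintro rfl; exact hc (zero_mem _)
    have hlt : h.order < 0 := by
      by_contra! hle
      exact hc (tO_mono hle (mem_tO_order h))
    have := mem_tO.1 H (h.order + h.order) (by omega)
    rw [HahnSeries.coeff_sub, HahnSeries.coeff_mul_order_add_order,
      HahnSeries.coeff_single_of_ne (by rintro rfl; obtain ⟨m, hm⟩ := hn; omega), zero_sub,
      neg_eq_zero, mul_self_eq_zero] at this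
    exact h0 (HahnSeries.leadingCoeff_eq_zero.1 this)
  refine ⟨?_, hh⟩
  by_contra! hlt
  have hs := (tO k 0).add_mem H (mul_mem_tO hh hh (c := 0) (by simp))
  rw [sub_add_cancel] at hs
  have := mem_tO.1 hs n hlt
  simp at this

theorem relIndex_tO [Finite k] {a c : ℤ} (m : ℕ) (h : c = a + m) :
    (tO k c).toAddSubgroup.relIndex (tO k a).toAddSubgroup = Nat.card k ^ m := by
  let f : LaurentSeries k →+ (Fin m → k) :=
    { toFun := fun x i => x.coeff (a + (i : ℕ))
      map_zero' := by ext; simp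
      map_add' := by intros; ext; simp }
  have hf_apply (x : LaurentSeries k) (i : Fin m) : f x i = x.coeff (a + (i : ℕ)) := rfl
  have hker : (tO k c).toAddSubgroup = f.ker ⊓ (tO k a).toAddSubgroup := by
    ext x
    simp only [AddSubgroup.mem_inf, Submodule.mem_toAddSubgroup, AddMonoidHom.mem_ker, mem_tO]
    constructor
    · intro hx
      exact ⟨funext fun i => hx _ (by have := i.2; omega), fun n hn => hx n (by omega)⟩
    · rintro ⟨hf, hx⟩ n hn
      by_cases hna : n < a
      · exact hx n hna
      · have hn0 : x.coeff (a + ((n - a).toNat : ℤ)) = 0 :=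
          congrFun hf ⟨(n - a).toNat, by omega⟩
        rwa [show a + ((n - a).toNat : ℤ) = n by omega] at hn0
  have hmap : (tO k a).toAddSubgroup.map f = ⊤ := by
    rw [eq_top_iff]
    intro y _
    refine ⟨(PowerSeries.mk fun n => if hn : n < m then y ⟨n, hn⟩ else 0) •
      HahnSeries.single a 1, mem_tO_iff_exists.2 ⟨_, rfl⟩, funext fun i => ?_⟩
    rw [hf_apply, powerSeries_smul_eq, HahnSeries.coeff_mul_single, PowerSeries.coeff_coe,
      if_neg (by omega), PowerSeries.coeff_mk, mul_one]
    simp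
  rw [hker, AddSubgroup.inf_relIndex_right, AddSubgroup.relIndex_ker, hmap]
  simp [Nat.card_fun]

end OneDimensional

section Index

theorem AddSubgroup.relIndex_eq_map_mul_ker {G H : Type*} [AddCommGroup G] [AddCommGroup H]
    (p : G →+ H) {A B : AddSubgroup G} (hAB : A ≤ B) :
    A.relIndex B = (A.map p).relIndex (B.map p) * (A ⊓ p.ker).relIndex (B ⊓ p.ker) := by
  have h1 : (A.map p).relIndex (B.map p) = (A ⊔ p.ker).relIndex B := by
    rw [AddSubgroup.relIndex_map_map, ← AddSubgroup.relIndex_sup_right B (A ⊔ p.ker),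
      ← sup_assoc, sup_eq_left.2 hAB, sup_comm]
  have h2 : (A ⊓ p.ker).relIndex (B ⊓ p.ker) = A.relIndex ((A ⊔ p.ker) ⊓ B) := by
    rw [sup_inf_assoc_of_le _ hAB, AddSubgroup.relIndex_sup_left, inf_comm B,
      ← AddSubgroup.inf_relIndex_right A (p.ker ⊓ B),
      ← AddSubgroup.inf_relIndex_right (A ⊓ p.ker) (p.ker ⊓ B)]
    congr 1
    rw [inf_assoc, ← inf_assoc p.ker, inf_idem]
  have h3 := AddSubgroup.relIndex_inf_mul_relIndex A (A ⊔ p.ker) B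
  rw [inf_eq_left.2 (le_sup_left : A ≤ A ⊔ p.ker)] at h3
  rw [h1, h2, mul_comm, h3]

variable {k : Type} [Field k] {V : Type} [AddCommGroup V] [Module (PowerSeries k) V]

theorem card_pow_qdim [Finite k] {N P : Submodule (PowerSeries k) V}
    (h : P.toAddSubgroup.relIndex N.toAddSubgroup ≠ 0) :
    Nat.card k ^ qdim N P = P.toAddSubgroup.relIndex N.toAddSubgroup := by
  have hcard : Nat.card (↥N ⧸ Submodule.comap N.subtype (N ⊓ P)) =
      P.toAddSubgroup.relIndex N.toAddSubgroup := by
    have : Submodule.comap N.subtype (N ⊓ P) = Submodule.comap N.subtype P := by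
      ext x; simp
    rw [this]
    rfl
  let _ := Module.compHom (↥N ⧸ Submodule.comap N.subtype (N ⊓ P))
    (algebraMap k (PowerSeries k))
  have : Finite (↥N ⧸ Submodule.comap N.subtype (N ⊓ P)) :=
    Nat.finite_of_card_ne_zero (hcard ▸ h)
  exact (Module.natCard_eq_pow_finrank (K := k)).symm.trans hcard

/-- The relative length can be computed from the indices of a common submodule. -/
theorem relIdx_eq_sub [Finite k] {A B C : Submodule (PowerSeries k) V} (hA : C ≤ A)
    (hB : C ≤ B) {m n : ℕ} (hm : C.toAddSubgroup.relIndex A.toAddSubgroup = Nat.card k ^ m)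
    (hn : C.toAddSubgroup.relIndex B.toAddSubgroup = Nat.card k ^ n) :
    relIdx A B = m - n := by
  have hq : 1 < Nat.card k := Finite.one_lt_card
  have hC : C.toAddSubgroup ≤ A.toAddSubgroup ⊓ B.toAddSubgroup := le_inf hA hB
  have eA := AddSubgroup.relIndex_mul_relIndex _ _ _ hC inf_le_left
  have eB := AddSubgroup.relIndex_mul_relIndex _ _ _ hC inf_le_right
  rw [AddSubgroup.inf_relIndex_left, hm] at eA
  rw [AddSubgroup.inf_relIndex_right, hn] at eB
  have hA0 := right_ne_zero_of_mul (eA.trans_ne (pow_pos (by omega) _).ne')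
  have hB0 := right_ne_zero_of_mul (eB.trans_ne (pow_pos (by omega) _).ne')
  have hx := left_ne_zero_of_mul (eB.trans_ne (pow_pos (by omega) _).ne')
  rw [← card_pow_qdim hA0] at eA
  rw [← card_pow_qdim hB0] at eB
  have key : Nat.card k ^ (qdim A B + n) = Nat.card k ^ (qdim B A + m) := by
    rw [pow_add, pow_add, ← eA, ← eB]
    ring
  have := Nat.pow_right_injective hq key
  unfold relIdx
  omega

end Index

section Plane

variable {k : Type} [Field k]

/-- The lattice generated by `(t^a, g t^a)` and `(0, t^b)`. -/
noncomputable def hermiteLat (a b : ℤ) (g : LaurentSeries k) :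
    Submodule (PowerSeries k) (Fin 2 → LaurentSeries k) where
  carrier := {v | v 0 ∈ tO k a ∧ v 1 - g * v 0 ∈ tO k b}
  zero_mem' := by simp
  add_mem' := by
    rintro v w ⟨hv, hv'⟩ ⟨hw, hw'⟩
    refine ⟨add_mem hv hw, ?_⟩
    convert add_mem hv' hw' using 1
    simp only [Pi.add_apply]
    ring
  smul_mem' := by
    rintro o v ⟨hv, hv'⟩
    refine ⟨Submodule.smul_mem _ o hv, ?_⟩
    convert Submodule.smul_mem _ o hv' using 1
    rw [Pi.smul_apply, Pi.smul_apply, smul_sub, mul_smul_comm]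

theorem mem_hermiteLat {a b : ℤ} {g : LaurentSeries k} {v : Fin 2 → LaurentSeries k} :
    v ∈ hermiteLat a b g ↔ v 0 ∈ tO k a ∧ v 1 - g * v 0 ∈ tO k b :=
  Iff.rfl

theorem stdLat_eq_hermiteLat : stdLat k 2 = hermiteLat 0 0 0 := by
  ext v
  simp [stdLat, diagLat, mem_hermiteLat, Submodule.mem_pi, Fin.forall_fin_two]

theorem hermiteLat_congr {a b : ℤ} {g g' : LaurentSeries k} (h : g - g' ∈ tO k (b - a)) :
    hermiteLat a b g = hermiteLat a b g' := by
  ext v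
  refine and_congr_right fun hv => ?_
  have hd := mul_mem_tO h hv (c := b) (by omega)
  have e : v 1 - g' * v 0 = (v 1 - g * v 0) + (g - g') * v 0 := by ring
  rw [e]
  exact ((tO k b).add_mem_iff_left hd).symm

theorem fst_mem_hermiteLat (a b : ℤ) (g : LaurentSeries k) :
    ![HahnSeries.single a 1, g * HahnSeries.single a 1] ∈ hermiteLat a b g := by
  simp [mem_hermiteLat, single_mem_tO]

theorem snd_mem_hermiteLat (a b : ℤ) (g : LaurentSeries k) :
    ![0, HahnSeries.single b 1] ∈ hermiteLat a b g := by
  simp [mem_hermiteLat, single_mem_tO]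

theorem isLattice_hermiteLat (a b : ℤ) (g : LaurentSeries k) : IsLattice (hermiteLat a b g) := by
  constructor
  · refine Submodule.fg_def.2
      ⟨{![HahnSeries.single a 1, g * HahnSeries.single a 1], ![0, HahnSeries.single b 1]},
        Set.toFinite _, le_antisymm (Submodule.span_le.2 ?_) fun v hv => ?_⟩
    · rintro v (rfl | rfl)
      · exact fst_mem_hermiteLat a b g
      · exact snd_mem_hermiteLat a b g
    · obtain ⟨o, ho⟩ := mem_tO_iff_exists.1 hv.1
      obtain ⟨p, hp⟩ := mem_tO_iff_exists.1 hv.2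
      refine Submodule.mem_span_pair.2 ⟨o, p, ?_⟩
      ext i : 1
      fin_cases i
      · simpa using ho
      · simp only [Fin.mk_one, Pi.add_apply, Pi.smul_apply, Matrix.cons_val_one,
          Matrix.cons_val_fin_one]
        rw [← mul_smul_comm, ho, hp]
        ring
  · rw [eq_top_iff]
    intro v _
    have h1 := Submodule.smul_mem _ (v 0 * HahnSeries.single (-a) 1)
      (Submodule.subset_span (R := LaurentSeries k) (fst_mem_hermiteLat a b g))
    have h2 := Submodule.smul_mem _ ((v 1 - g * v 0) * HahnSeries.single (-b) 1)
      (Submodule.subset_span (R := LaurentSeries k) (snd_mem_hermiteLat a b g))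
    convert Submodule.add_mem _ h1 h2 using 1
    ext i : 1
    fin_cases i
    · simp only [Fin.zero_eta, Pi.add_apply, Pi.smul_apply, Matrix.cons_val_zero, smul_eq_mul]
      linear_combination (-v 0) * single_mul_single_neg (k := k) a
    · simp only [Fin.mk_one, Pi.add_apply, Pi.smul_apply, Matrix.cons_val_one,
        Matrix.cons_val_fin_one, smul_eq_mul]
      linear_combination (-(g * v 0)) * single_mul_single_neg (k := k) a -
        (v 1 - g * v 0) * single_mul_single_neg (k := k) b

theorem relIndex_hermiteLat [Finite k] {a b c d : ℤ} {g g' : LaurentSeries k}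
    (h : hermiteLat c d g' ≤ hermiteLat a b g) (m n : ℕ) (hm : c = a + m) (hn : d = b + n) :
    (hermiteLat c d g').toAddSubgroup.relIndex (hermiteLat a b g).toAddSubgroup =
      Nat.card k ^ (m + n) := by
  let p : (Fin 2 → LaurentSeries k) →+ LaurentSeries k := Pi.evalAddMonoidHom _ 0
  let i : LaurentSeries k →+ (Fin 2 → LaurentSeries k) := 
    AddMonoidHom.single (fun _ : Fin 2 => LaurentSeries k) 1
  have hp (a b : ℤ) (g : LaurentSeries k) :
      (hermiteLat a b g).toAddSubgroup.map p = (tO k a).toAddSubgroup := by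
    ext x
    constructor
    · rintro ⟨v, hv, rfl⟩
      exact hv.1
    · intro hx
      exact ⟨![x, g * x], ⟨hx, by simp⟩, rfl⟩
  have hi (a b : ℤ) (g : LaurentSeries k) :
      (hermiteLat a b g).toAddSubgroup ⊓ p.ker = (tO k b).toAddSubgroup.map i := by
    ext v
    constructor
    · rintro ⟨hv, h0⟩
      have h0 : v 0 = 0 := h0
      refine ⟨v 1, by simpa [h0] using hv.2, ?_⟩
      ext j : 1
      fin_cases j <;> simp [i, h0]
    · rintro ⟨y, hy, rfl⟩
      have hy : y ∈ tO k b := hy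
      exact ⟨by simp [i, mem_hermiteLat, hy], by simp [i, p]⟩
  rw [AddSubgroup.relIndex_eq_map_mul_ker p h, hp, hp, hi, hi,
    AddSubgroup.relIndex_map_map_of_injective _ _
      (Pi.single_injective (M := fun _ : Fin 2 => LaurentSeries k) 1), relIndex_tO m hm,
    relIndex_tO n hn, pow_add]

theorem relIdx_hermiteLat [Finite k] (a b : ℤ) (g : LaurentSeries k) :
    relIdx (hermiteLat a b g) (stdLat k 2) = -(a + b) := by
  rw [stdLat_eq_hermiteLat]
  obtain ⟨N, hN⟩ : ∃ N : ℕ, a ≤ N ∧ b ≤ N ∧ b ≤ g.order + N :=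
    by
    refine ⟨(max (max a b) (b - g.order)).toNat, ?_, ?_, ?_⟩ <;> omega
  have hle : hermiteLat (N : ℤ) (N : ℤ) 0 ≤ hermiteLat a b g := by
    rintro v ⟨h0, h1⟩
    rw [zero_mul, sub_zero] at h1
    exact ⟨tO_mono hN.1 h0,
      sub_mem (tO_mono hN.2.1 h1) (mul_mem_tO (mem_tO_order g) h0 hN.2.2)⟩
  have hle' : hermiteLat (N : ℤ) (N : ℤ) (0 : LaurentSeries k) ≤ hermiteLat 0 0 0 := fun v hv =>
    ⟨tO_mono (by simp) hv.1, tO_mono (by simp) hv.2⟩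
  rw [relIdx_eq_sub hle hle'
    (relIndex_hermiteLat hle (N - a).toNat (N - b).toNat (by omega) (by omega))
    (relIndex_hermiteLat hle' N N (by simp) (by simp))]
  omega

theorem exists_bound_of_fg {n : ℕ} {L : Submodule (PowerSeries k) (Fin n → LaurentSeries k)}
    (h : L.FG) : ∃ M : ℤ, L ≤ diagLat k fun _ => M := by
  induction L, h using Submodule.fg_induction with
  | singleton v =>
    obtain ⟨M, hM⟩ := (Set.finite_range fun i => (v i).order).bddBelow
    refine ⟨M, (Submodule.span_singleton_le_iff_mem _ _).2 fun i _ => ?_⟩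
    exact tO_mono (hM ⟨i, rfl⟩) (mem_tO_order _)
  | sup L₁ L₂ _ _ ih₁ ih₂ =>
    obtain ⟨M₁, h₁⟩ := ih₁
    obtain ⟨M₂, h₂⟩ := ih₂
    exact ⟨min M₁ M₂, sup_le
      (h₁.trans fun v hv i hi => tO_mono (min_le_left _ _) (hv i hi))
      (h₂.trans fun v hv i hi => tO_mono (min_le_right _ _) (hv i hi))⟩

theorem exists_smul_mem_of_mem_span {V : Type*} [AddCommGroup V] [Module (PowerSeries k) V]
    [Module (LaurentSeries k) V] [IsScalarTower (PowerSeries k) (LaurentSeries k) V]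
    {L : Submodule (PowerSeries k) V} {v : V}
    (hv : v ∈ Submodule.span (LaurentSeries k) (L : Set V)) :
    ∃ N : ℤ, ∀ x ∈ tO k N, x • v ∈ L := by
  induction hv using Submodule.span_induction with
  | mem v hv =>
    refine ⟨0, fun x hx => ?_⟩
    obtain ⟨o, rfl⟩ := exists_coe_eq_of_mem_tO_zero hx
    have : (o : LaurentSeries k) • v = o • v := algebraMap_smul (LaurentSeries k) o v
    rw [this]
    exact L.smul_mem o hv
  | zero => exact ⟨0, fun x _ => by simp⟩
  | add v w _ _ hv hw =>
    obtain ⟨N₁, h₁⟩ := hv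
    obtain ⟨N₂, h₂⟩ := hw
    refine ⟨max N₁ N₂, fun x hx => ?_⟩
    rw [smul_add]
    exact add_mem (h₁ x (tO_mono (le_max_left _ _) hx)) (h₂ x (tO_mono (le_max_right _ _) hx))
  | smul c v _ hv =>
    obtain ⟨N, h⟩ := hv
    refine ⟨N - c.order, fun x hx => ?_⟩
    rw [smul_smul]
    exact h _ (mul_mem_tO hx (mem_tO_order c) (by omega))

theorem IsLattice.exists_eq_hermiteLat
    {L : Submodule (PowerSeries k) (Fin 2 → LaurentSeries k)} (hL : IsLattice L) :
    ∃ a b g, L = hermiteLat a b g := by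
  obtain ⟨M, hM⟩ := exists_bound_of_fg hL.1
  have hspan (v : Fin 2 → LaurentSeries k) : ∃ x : LaurentSeries k, x ≠ 0 ∧ x • v ∈ L := by
    obtain ⟨N, hN⟩ := exists_smul_mem_of_mem_span (L := L) (v := v) (hL.2 ▸ Submodule.mem_top)
    exact ⟨_, HahnSeries.single_ne_zero one_ne_zero, hN _ (single_mem_tO le_rfl 1)⟩
  obtain ⟨a, ha⟩ : ∃ a, L.map (LinearMap.proj 0) = tO k a := by
    obtain ⟨x, hx, hxL⟩ := hspan (Pi.single 0 1)
    refine exists_eq_tO (M := M) ?_ ?_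
    · refine (Submodule.ne_bot_iff _).2 ⟨x, ⟨_, hxL, by simp⟩, hx⟩
    · rintro _ ⟨v, hv, rfl⟩
      exact hM hv 0 trivial
  obtain ⟨b, hb⟩ : ∃ b, L.comap (LinearMap.single (PowerSeries k)
      (fun _ : Fin 2 => LaurentSeries k) 1) = tO k b := by
    obtain ⟨x, hx, hxL⟩ := hspan (Pi.single 1 1)
    refine exists_eq_tO (M := M) ?_ ?_
    · refine (Submodule.ne_bot_iff _).2 ⟨x, ?_, hx⟩
      simpa [← Pi.single_smul] using hxL
    · intro y hy
      simpa using hM hy 1 trivial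
  obtain ⟨w, hw, hwa⟩ : HahnSeries.single a 1 ∈ L.map (LinearMap.proj 0) :=
    ha ▸ single_mem_tO le_rfl 1
  have hwa : w 0 = HahnSeries.single a 1 := hwa
  refine ⟨a, b, w 1 * HahnSeries.single (-a) 1, ?_⟩
  ext v
  rw [mem_hermiteLat, ← hb, Submodule.mem_comap]
  have key (o : PowerSeries k) (ho : o • (HahnSeries.single a 1 : LaurentSeries k) = v 0) :
      v = o • w + LinearMap.single (PowerSeries k) (fun _ : Fin 2 => LaurentSeries k) 1
        (v 1 - w 1 * HahnSeries.single (-a) 1 * v 0) := by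
    ext i : 1
    fin_cases i
    · simp [hwa, ho]
    · simp only [Fin.mk_one, Pi.add_apply, Pi.smul_apply, LinearMap.coe_single,
        Pi.single_eq_same, ← ho, powerSeries_smul_eq]
      linear_combination (w 1 * (o : LaurentSeries k)) * single_mul_single_neg (k := k) a
  constructor
  · intro hv
    have hv0 : v 0 ∈ tO k a := ha ▸ ⟨v, hv, rfl⟩
    obtain ⟨o, ho⟩ := mem_tO_iff_exists.1 hv0
    refine ⟨hv0, ?_⟩
    rw [key o ho] at hv
    exact (L.add_mem_iff_right (L.smul_mem o hw)).1 hv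
  · rintro ⟨hv0, hv1⟩
    obtain ⟨o, ho⟩ := mem_tO_iff_exists.1 hv0
    rw [key o ho]
    exact L.add_mem (L.smul_mem o hw) hv1

end Plane

section SpringerFiber

variable {k : Type} [Field k]

theorem gamma_mulVec (v : Fin 2 → LaurentSeries k) :
    (Matrix.of ![![0, HahnSeries.single 2 1], ![HahnSeries.single 1 1, 0]] :
      Matrix (Fin 2) (Fin 2) (LaurentSeries k)).mulVec v =
      ![HahnSeries.single 2 1 * v 1, HahnSeries.single 1 1 * v 0] := by
  ext i : 1
  fin_cases i <;> simp [Matrix.mulVec, dotProduct, Fin.sum_univ_two]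

/-- The points of the affine Springer fiber, with `none` the point at infinity. -/
noncomputable def springerPoint :
    Option k → Submodule (PowerSeries k) (Fin 2 → LaurentSeries k)
  | none => hermiteLat 1 (-1) 0
  | some c => hermiteLat 0 0 (HahnSeries.single (-1) c)

theorem springerPoint_injective : Function.Injective (springerPoint (k := k)) := by
  have hnone (c : k) : hermiteLat 1 (-1) 0 ≠ hermiteLat 0 0 (HahnSeries.single (-1) c) := by
    intro h
    have hmem := fst_mem_hermiteLat 0 0 (HahnSeries.single (-1) c)
    rw [← h] at hmem
    simpa using mem_tO.1 hmem.1 0 one_pos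
  rintro (_ | c) (_ | d) h
  · rfl
  · exact absurd h (hnone d)
  · exact absurd h.symm (hnone c)
  · have hmem := fst_mem_hermiteLat 0 0 (HahnSeries.single (-1) c)
    change hermiteLat 0 0 _ = hermiteLat 0 0 _ at h
    rw [h] at hmem
    have := mem_tO.1 hmem.2 (-1) (by norm_num)
    simp [sub_eq_zero] at this
    rw [this]

theorem springerPoint_stable (o : Option k) {v : Fin 2 → LaurentSeries k}
    (hv : v ∈ springerPoint o) :
    ![HahnSeries.single 2 1 * v 1, HahnSeries.single 1 1 * v 0] ∈ springerPoint o := by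
  rcases o with _ | c
  · obtain ⟨h0, h1⟩ := hv
    rw [zero_mul, sub_zero] at h1
    refine ⟨single_mul_mem_tO 2 1 h1 (by norm_num), ?_⟩
    simpa using single_mul_mem_tO 1 1 h0 (a := -1) (by norm_num)
  · obtain ⟨h0, h1⟩ := hv
    have h1 : v 1 ∈ tO k (-1) := by
      have := add_mem (tO_mono (b := -1) (by norm_num) h1)
        (single_mul_mem_tO (-1) c h0 (a := -1) (by norm_num))
      rwa [sub_add_cancel] at this
    have h2 := single_mul_mem_tO 2 1 h1 (a := 1) (by norm_num)
    exact ⟨tO_mono (by norm_num) h2, sub_mem (single_mul_mem_tO 1 1 h0 (by norm_num))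
      (single_mul_mem_tO (-1) c h2 (by norm_num))⟩

theorem hermiteLat_eq_springerPoint {a : ℤ} {g : LaurentSeries k}
    (h : ∀ v ∈ hermiteLat a (-a) g,
      ![HahnSeries.single 2 1 * v 1, HahnSeries.single 1 1 * v 0] ∈ hermiteLat a (-a) g) :
    ∃ o, springerPoint o = hermiteLat a (-a) g := by
  have h1 : a ≤ 1 := by
    by_contra! hlt
    have := mem_tO.1 (h _ (snd_mem_hermiteLat a (-a) g)).1 (2 - a) (by omega)
    simp [HahnSeries.single_mul_single, sub_eq_add_neg] at this
  have h2 : 0 ≤ 2 * a + 1 ∧ g * HahnSeries.single (a + 1) 1 ∈ tO k 0 := by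
    refine integral_of_single_sub_sq ⟨a, rfl⟩ ?_
    have := single_mul_mem_tO a 1 (h _ (fst_mem_hermiteLat a (-a) g)).2 (a := 0) (by simp)
    convert this using 1
    have e1 : (HahnSeries.single (2 * a + 1) 1 : LaurentSeries k) =
        HahnSeries.single a 1 * (HahnSeries.single 1 1 * HahnSeries.single a 1) := by
      simp only [HahnSeries.single_mul_single, mul_one]
      rw [show a + (1 + a) = 2 * a + 1 by ring]
    have e2 : (HahnSeries.single (a + 1) 1 : LaurentSeries k) =
        HahnSeries.single a 1 * HahnSeries.single 1 1 := by
      simp only [HahnSeries.single_mul_single, mul_one]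
    have e3 : (HahnSeries.single 2 1 : LaurentSeries k) =
        HahnSeries.single 1 1 * HahnSeries.single 1 1 := by
      simp only [HahnSeries.single_mul_single, mul_one]
      norm_num
    simp only [e1, e2, e3, Matrix.cons_val_zero, Matrix.cons_val_one, Matrix.cons_val_fin_one]
    ring
  have hg : g ∈ tO k (-(a + 1)) := by
    have := single_mul_mem_tO (-(a + 1)) 1 h2.2 (a := -(a + 1)) (by simp)
    convert this using 1
    linear_combination (-g) * single_mul_single_neg (k := k) (a + 1)
  obtain rfl | rfl : a = 0 ∨ a = 1 := by omega
  · refine ⟨some (g.coeff (-1)), (hermiteLat_congr (mem_tO.2 fun n hn => ?_)).symm⟩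
    rw [HahnSeries.coeff_sub]
    obtain rfl | hn' := eq_or_ne n (-1)
    · simp
    · rw [HahnSeries.coeff_single_of_ne hn', mem_tO.1 hg n (by omega), sub_zero]
  · exact ⟨none, (hermiteLat_congr (by simpa using hg)).symm⟩

end SpringerFiber

theorem stmt15 (k : Type) [Field k] [Fintype k] (hodd : Odd (Fintype.card k))
    (γ : Matrix (Fin 2) (Fin 2) (LaurentSeries k))
    (hγ : γ = Matrix.of ![![0, HahnSeries.single 2 1], ![HahnSeries.single 1 1, 0]]) :
    {Λ : Submodule (PowerSeries k) (Fin 2 → LaurentSeries k) |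
        IsLattice Λ ∧ relIdx Λ (stdLat k 2) = 0 ∧
          ∀ v ∈ Λ, γ.mulVec v ∈ Λ}.Finite ∧
    {Λ : Submodule (PowerSeries k) (Fin 2 → LaurentSeries k) |
        IsLattice Λ ∧ relIdx Λ (stdLat k 2) = 0 ∧
          ∀ v ∈ Λ, γ.mulVec v ∈ Λ}.ncard = Fintype.card k + 1 := by
  have hset : {Λ : Submodule (PowerSeries k) (Fin 2 → LaurentSeries k) |
      IsLattice Λ ∧ relIdx Λ (stdLat k 2) = 0 ∧ ∀ v ∈ Λ, γ.mulVec v ∈ Λ} =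
      Set.range springerPoint := by
    subst hγ
    simp only [gamma_mulVec]
    ext Λ
    constructor
    · rintro ⟨hΛ, hidx, hst⟩
      obtain ⟨a, b, g, rfl⟩ := hΛ.exists_eq_hermiteLat
      rw [relIdx_hermiteLat] at hidx
      obtain rfl : b = -a := by omega
      exact hermiteLat_eq_springerPoint hst
    · rintro ⟨o, rfl⟩
      refine ⟨?_, ?_, fun v hv => springerPoint_stable o hv⟩
      · cases o <;> exact isLattice_hermiteLat _ _ _
      · cases o <;> exact (relIdx_hermiteLat _ _ _).trans (by norm_num)
  rw [hset]
  refine ⟨Set.finite_range _, ?_⟩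
  rw [← Set.image_univ, Set.ncard_image_of_injective _ springerPoint_injective, Set.ncard_univ,
    Nat.card_eq_fintype_card, Fintype.card_option]
end
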